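/- arXiv:2409.13883 — 2 statements merged into one kernel-verified Lean document; each statement's English description precedes it below -/
import Mathlib

section
/- Let (w, i, j) ∈ Γ(W). The following are equivalent: (1) there exist v ∈ W and i′ ∈ I with (v, i′, j) ∈ Γ(W), (w, i, j) →_L (v, i′, j), and ℓ(v) < ℓ(w); (2) the element w s_j has more than one left descent. -/
open CoxeterSystem

namespace NilpotencyIndices

variable {B : Type*} {W : Type*} [Group W] {M : CoxeterMatrix B}

/-- The set `Γ(W)` of triples `(w, i, j)` with `ℓ(sᵢ w sⱼ) = ℓ(w) - 2`
(stated as `ℓ(sᵢ w sⱼ) + 2 = ℓ(w)` to avoid truncated subtraction). -/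
def InGamma (cs : CoxeterSystem M W) (x : W × B × B) : Prop :=
  cs.length (cs.simple x.2.1 * x.1 * cs.simple x.2.2) + 2 = cs.length x.1

/-- The weak left (Bruhat) order: `v ≤_L w` iff `ℓ(v) + ℓ(w v⁻¹) = ℓ(w)`. -/
def WeakLeftLE (cs : CoxeterSystem M W) (v w : W) : Prop :=
  cs.length v + cs.length (w * v⁻¹) = cs.length w

/-- The weak right (Bruhat) order: `v ≤_R w` iff `ℓ(v) + ℓ(v⁻¹ w) = ℓ(w)`. -/
def WeakRightLE (cs : CoxeterSystem M W) (v w : W) : Prop :=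
  cs.length v + cs.length (v⁻¹ * w) = cs.length w

/-- `v(α_a) = α_b`: the group-theoretic condition `v sₐ v⁻¹ = s_b` and `ℓ(v sₐ) = ℓ(v) + 1`. -/
def MapsSimple (cs : CoxeterSystem M W) (v : W) (a b : B) : Prop :=
  v * cs.simple a * v⁻¹ = cs.simple b ∧ cs.length (v * cs.simple a) = cs.length v + 1

/-- `(w, i, j) →_L (u, i', j')` iff both triples are in `Γ(W)`, `u ≤_L w`, `j' = j`, and
`(w u⁻¹)(α_{i'}) = α_i`. -/
def RedL (cs : CoxeterSystem M W) (x y : W × B × B) : Prop :=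
  InGamma cs x ∧ InGamma cs y ∧ WeakLeftLE cs y.1 x.1 ∧ y.2.2 = x.2.2 ∧
    MapsSimple cs (x.1 * y.1⁻¹) y.2.1 x.2.1

/-- `(w, i, j) →_R (u, i', j')` iff both triples are in `Γ(W)`, `u ≤_R w`, `i' = i`, and
`(u⁻¹ w)(α_j) = α_{j'}`. -/
def RedR (cs : CoxeterSystem M W) (x y : W × B × B) : Prop :=
  InGamma cs x ∧ InGamma cs y ∧ WeakRightLE cs y.1 x.1 ∧ y.2.1 = x.2.1 ∧
    MapsSimple cs (y.1⁻¹ * x.1) x.2.2 y.2.2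

/-- `→`: the reflexive-transitive closure of the union of `→_L` and `→_R`. -/
def Red (cs : CoxeterSystem M W) : (W × B × B) → (W × B × B) → Prop :=
  Relation.ReflTransGen (fun x y => RedL cs x y ∨ RedR cs x y)

/-- `↔`: the equivalence relation generated by `→`. -/
def EquivRed (cs : CoxeterSystem M W) : (W × B × B) → (W × B × B) → Prop :=
  Relation.EqvGen (Red cs)

/-- The alternating word `a, b, a, b, …` with `n` letters, starting with `a`. -/
def altWord (a b : B) : ℕ → List B
  | 0 => []
  | n + 1 => a :: altWord b a n

/-- `w₀(a, b)`: the alternating product `sₐ s_b sₐ ⋯` with `M a b` factors, the longest element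
of the subgroup generated by `sₐ` and `s_b` when `M a b` is finite (i.e. nonzero). -/
def w0 (cs : CoxeterSystem M W) (a b : B) : W :=
  cs.wordProd (altWord a b (M a b))

/-- An element is bigrassmannian if it has exactly one left descent and exactly one
right descent. -/
def Bigrassmannian (cs : CoxeterSystem M W) (w : W) : Prop :=
  (∃! i, cs.IsLeftDescent w i) ∧ (∃! j, cs.IsRightDescent w j)

/-- The support of `w`: the set of indices appearing in some reduced word for `w`. -/
def Supp (cs : CoxeterSystem M W) (w : W) : Set B :=
  {i | ∃ l : List B, cs.IsReduced l ∧ cs.wordProd l = w ∧ i ∈ l}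

/-- The relation `(w, i, j) →_{(k,L)} (u, i', j')`. -/
def RedkL (cs : CoxeterSystem M W) (k : B) (x y : W × B × B) : Prop :=
  cs.length y.1 < cs.length x.1 ∧ RedR cs (x.1 * cs.simple k, x.2.1, x.2.2) x ∧
    RedL cs (x.1 * cs.simple k, x.2.1, x.2.2) y ∧ WeakLeftLE cs y.1 x.1

/-- The relation `(w, i, j) →_{(k,R)} (u, i', j')`. -/
def RedkR (cs : CoxeterSystem M W) (k : B) (x y : W × B × B) : Prop :=
  cs.length y.1 < cs.length x.1 ∧ RedL cs (cs.simple k * x.1, x.2.1, x.2.2) x ∧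
    RedR cs (cs.simple k * x.1, x.2.1, x.2.2) y ∧ WeakRightLE cs y.1 x.1

/-- The orthogonality condition for a bigrassmannian element `w` with `D_L(w) = {i}` and
`D_R(w) = {j}`. -/
def OrthCond (cs : CoxeterSystem M W) (w : W) (i j : B) : Prop :=
  (∀ a b : B, M a j = 2 → MapsSimple cs w a b → M b i = 2) ∧
  (∀ a b : B, M a i = 2 → MapsSimple cs w⁻¹ a b → M b j = 2)

section GeometricRepresentation

open Polynomial Chebyshev

theorem sin_mul_eval_S (φ : ℝ) (k : ℤ) :
    Real.sin φ * (S ℝ k).eval (2 * Real.cos φ) = Real.sin ((k + 1) * φ) := by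
  induction k using Polynomial.Chebyshev.induct with
  | zero => simp
  | one => simp [one_add_one_eq_two, Real.sin_two_mul]; ring
  | add_two n ih1 ih2 =>
    rw [S_add_two, eval_sub, eval_mul, eval_X, mul_sub, ih2, mul_left_comm, ih1]
    have h := Real.two_mul_sin_mul_cos (((n : ℝ) + 1 + 1) * φ) φ
    push_cast
    ring_nf at h ⊢
    linarith
  | neg_add_one n ih1 ih2 =>
    have e : S ℝ (-(n : ℤ) - 1) = X * S ℝ (-(n : ℤ)) - S ℝ (-(n : ℤ) + 1) := S_sub_one ℝ _
    rw [e, eval_sub, eval_mul, eval_X, mul_sub, ih2, mul_left_comm, ih1]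
    have h := Real.two_mul_sin_mul_cos ((-(n : ℝ) + 1) * φ) φ
    push_cast
    ring_nf at h ⊢
    linarith

/-- The linear form `v ↦ 2 B(e_a, v)` of the geometric representation. -/
noncomputable def geomForm (M : CoxeterMatrix B) (a : B) : Module.Dual ℝ (B →₀ ℝ) :=
  Finsupp.linearCombination ℝ fun b ↦ -2 * Real.cos (Real.pi / M a b)

theorem geomForm_single (M : CoxeterMatrix B) (a b : B) :
    geomForm M a (Finsupp.single b 1) = -2 * Real.cos (Real.pi / M a b) := by
  simp [geomForm]

theorem geomForm_single_self (M : CoxeterMatrix B) (a : B) :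
    geomForm M a (Finsupp.single a 1) = 2 := by
  simp [geomForm_single]

theorem isLiftable_reflection (M : CoxeterMatrix B) :
    M.IsLiftable fun a ↦ Module.reflection (geomForm_single_self M a) := by
  intro a b
  rcases eq_or_ne a b with rfl | hab
  · rw [M.diagonal, pow_one]
    ext1 v
    exact Module.involutive_reflection (geomForm_single_self M a) v
  obtain hm | hm | hm : M a b = 0 ∨ M a b = 2 ∨ 3 ≤ M a b := by
    have := M.off_diagonal a b hab
    lia
  · simp [hm]
  · ext1 v
    have hm' : M b a = 2 := M.symmetric b a ▸ hm
    rw [Module.reflection_mul_reflection_pow_apply]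
    simp [geomForm_single, hm, hm']
    module
  · set m := M a b with hm_def
    have hm0 : (m : ℝ) ≠ 0 := by positivity
    have hsin : Real.sin (2 * Real.pi / m) ≠ 0 := by
      apply ne_of_gt
      apply Real.sin_pos_of_pos_of_lt_pi (by positivity)
      rw [div_lt_iff₀ (by positivity)]
      have : (3 : ℝ) ≤ m := by exact_mod_cast hm
      nlinarith [Real.pi_pos]
    have ht : 2 * Real.cos (2 * Real.pi / m) =
        geomForm M a (Finsupp.single b 1) * geomForm M b (Finsupp.single a 1) - 2 := by
      rw [geomForm_single, geomForm_single, M.symmetric b a, ← hm_def, mul_div_assoc,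
        Real.cos_two_mul]
      ring
    have hS (k : ℤ) (hk : 2 * (k + 1) = m) :
        (S ℝ k).eval (2 * Real.cos (2 * Real.pi / m)) = 0 := by
      apply (mul_eq_zero.mp _).resolve_left hsin
      have hk' : (m : ℝ) = 2 * (k + 1) := by exact_mod_cast hk.symm
      have : ((k : ℝ) + 1) * (2 * Real.pi / m) = Real.pi := by
        rw [mul_div_assoc', div_eq_iff hm0, hk']
        ring
      rw [sin_mul_eval_S, this, Real.sin_pi]
    have hS' (k : ℤ) (hk : 2 * k + 1 = m) :
        (S ℝ k).eval (2 * Real.cos (2 * Real.pi / m)) +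
          (S ℝ (k - 1)).eval (2 * Real.cos (2 * Real.pi / m)) = 0 := by
      apply (mul_eq_zero.mp _).resolve_left hsin
      have hk' : (m : ℝ) = 2 * k + 1 := by exact_mod_cast hk.symm
      have : ((k : ℝ) + 1) * (2 * Real.pi / m) =
          2 * Real.pi - ((k - 1 : ℤ) + 1) * (2 * Real.pi / m) := by
        field_simp
        push_cast
        rw [hk']
        ring
      rw [mul_add, sin_mul_eval_S, sin_mul_eval_S, this, Real.sin_two_pi_sub]
      ring
    ext1 v
    rw [Module.reflection_mul_reflection_pow_apply _ _ _ _ _ ht]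
    rcases Nat.even_or_odd' m with ⟨k, hk | hk⟩
    · have e1 : ((m : ℤ) - 2) / 2 = k - 1 := by lia
      have e2 : ((m : ℤ) - 1) / 2 = k - 1 := by lia
      rw [e1, e2, hS (k - 1) (by lia)]
      simp
    · have e1 : ((m : ℤ) - 2) / 2 = k - 1 := by lia
      have e2 : ((m : ℤ) - 1) / 2 = k := by lia
      have e3 : ((m : ℤ) - 3) / 2 = k - 1 := by lia
      have e4 : (m : ℤ) / 2 = k := by lia
      rw [e1, e2, e3, e4, hS' k (by lia)]
      simp

theorem simple_injective (cs : CoxeterSystem M W) : Function.Injective cs.simple := by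
  intro a b hab
  by_contra hne
  have h := congrArg (cs.lift ⟨_, isLiftable_reflection M⟩) hab
  rw [lift_apply_simple, lift_apply_simple] at h
  have h' := DFunLike.congr_fun (LinearEquiv.congr_fun h (Finsupp.single a 1)) a
  rw [Module.reflection_apply_self, Module.reflection_apply] at h'
  norm_num [Finsupp.single_apply, Ne.symm hne] at h'

end GeometricRepresentation

section Exchange

theorem end_mul_apply {α : Type*} (f g : Function.End α) (x : α) : (f * g) x = f (g x) := rfl

open Classical in
/-- The action of `sᵢ` on pairs `(t, ε)`: conjugation on `t`, flipping the sign iff `t = sᵢ`. -/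
noncomputable def signedConj (cs : CoxeterSystem M W) (i : B) : Function.End (W × ZMod 2) :=
  fun x ↦ (cs.simple i * x.1 * cs.simple i, x.2 + if x.1 = cs.simple i then 1 else 0)

open Classical in
theorem signedConj_mul_pow_apply (cs : CoxeterSystem M W) (i j : B) (n : ℕ) (x : W × ZMod 2) :
    ((signedConj cs i * signedConj cs j) ^ n) x =
      ((cs.simple i * cs.simple j) ^ n * x.1 * ((cs.simple i * cs.simple j) ^ n)⁻¹,
        x.2 + ∑ l ∈ Finset.range (2 * n),
          if x.1 = cs.simple j * (cs.simple i * cs.simple j) ^ l then 1 else 0) := by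
  induction n with
  | zero => simp [Function.End.one_def]
  | succ n ih =>
    rw [pow_succ', end_mul_apply, ih, end_mul_apply]
    set r := cs.simple i * cs.simple j with hr
    have hjr : cs.simple j * r * cs.simple j = r⁻¹ := by simp [hr, mul_assoc]
    have hjrn (n : ℕ) : cs.simple j * r ^ n = (r ^ n)⁻¹ * cs.simple j := by
      have := conj_pow (i := n) (a := cs.simple j) (b := r)
      rw [inv_simple, hjr, inv_pow] at this
      rw [this]
      simp [mul_assoc]
    have h1 : r ^ n * x.1 * (r ^ n)⁻¹ = cs.simple j ↔ x.1 = cs.simple j * r ^ (2 * n) := by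
      rw [mul_inv_eq_iff_eq_mul, ← eq_inv_mul_iff_mul_eq, ← mul_assoc, ← hjrn, mul_assoc,
        ← pow_add, two_mul]
    have h2 : cs.simple j * (r ^ n * x.1 * (r ^ n)⁻¹) * cs.simple j = cs.simple i ↔
        x.1 = cs.simple j * r ^ (2 * n + 1) := by
      rw [← mul_left_inj (cs.simple j), simple_mul_simple_cancel_right,
        ← mul_right_inj (cs.simple j), simple_mul_simple_cancel_left, ← hr,
        mul_inv_eq_iff_eq_mul, ← eq_inv_mul_iff_mul_eq, mul_assoc, ← mul_assoc, ← hjrn,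
        ← pow_succ', mul_assoc, ← pow_add, two_mul, add_assoc]
    simp only [signedConj, h1, h2, mul_add, mul_one, Finset.sum_range_succ]
    ext
    · simp [hr, pow_succ', mul_assoc]
    · simp [add_assoc]

theorem isLiftable_signedConj (cs : CoxeterSystem M W) : M.IsLiftable (signedConj cs) := by
  classical
  intro i j
  funext x
  rw [signedConj_mul_pow_apply, two_mul, Finset.sum_range_add]
  simp only [pow_add, simple_mul_simple_pow, one_mul, CharTwo.add_self_eq_zero]
  simp [Function.End.one_def]

open Classical in
theorem lift_signedConj_wordProd (cs : CoxeterSystem M W) (ω : List B) (t : W) :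
    cs.lift ⟨_, isLiftable_signedConj cs⟩ (cs.wordProd ω) (t, 0) =
      (cs.wordProd ω * t * (cs.wordProd ω)⁻¹, ((cs.rightInvSeq ω).count t : ZMod 2)) := by
  induction ω with
  | nil => simp [Function.End.one_def]
  | cons i ω ih =>
    rw [wordProd_cons, map_mul, end_mul_apply, ih, lift_apply_simple,
      signedConj, rightInvSeq, List.count_cons]
    have h : cs.wordProd ω * t * (cs.wordProd ω)⁻¹ = cs.simple i ↔
        (cs.wordProd ω)⁻¹ * cs.simple i * cs.wordProd ω = t := by
      rw [mul_inv_eq_iff_eq_mul, mul_assoc, inv_mul_eq_iff_eq_mul, eq_comm]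
    simp only [h, beq_iff_eq]
    ext
    · simp [mul_assoc]
    · push_cast
      rfl

theorem count_rightInvSeq_congr [DecidableEq W] (cs : CoxeterSystem M W) {ω ω' : List B}
    (h : cs.wordProd ω = cs.wordProd ω') (t : W) :
    ((cs.rightInvSeq ω).count t : ZMod 2) = (cs.rightInvSeq ω').count t := by
  have h1 := lift_signedConj_wordProd cs ω t
  rw [h, lift_signedConj_wordProd] at h1
  convert! (congrArg Prod.snd h1).symm

theorem simple_mem_rightInvSeq (cs : CoxeterSystem M W) {ω : List B} {i : B}
    (h : cs.IsRightDescent (cs.wordProd ω) i) : cs.simple i ∈ cs.rightInvSeq ω := by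
  classical
  obtain ⟨ω', hω', hw⟩ := cs.exists_isReduced (cs.wordProd ω * cs.simple i)
  have hprod : cs.wordProd ω = cs.wordProd (ω'.concat i) := by
    rw [wordProd_concat, ← hw, simple_mul_simple_cancel_right]
  have hred : cs.IsReduced (ω'.concat i) := by
    rw [isRightDescent_iff, hw, hω'.eq] at h
    rw [CoxeterSystem.IsReduced, ← hprod, ← h, List.length_concat]
  have hcount := count_rightInvSeq_congr cs hprod (cs.simple i)
  have hlast : cs.simple i ∈ cs.rightInvSeq (ω'.concat i) := by
    rw [rightInvSeq_concat]
    simp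
  rw [List.count_eq_one_of_mem hred.nodup_rightInvSeq hlast] at hcount
  by_contra hmem
  rw [List.count_eq_zero_of_not_mem hmem] at hcount
  simp at hcount

/-- The exchange property. -/
theorem exists_simple_mul_wordProd_eq_eraseIdx (cs : CoxeterSystem M W) {ω : List B} {i : B}
    (h : cs.IsLeftDescent (cs.wordProd ω) i) :
    ∃ p < ω.length, cs.simple i * cs.wordProd ω = cs.wordProd (ω.eraseIdx p) := by
  have hmem : cs.simple i ∈ cs.leftInvSeq ω := by
    rw [← List.mem_reverse, ← rightInvSeq_reverse]
    apply simple_mem_rightInvSeq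
    rwa [wordProd_reverse, isRightDescent_inv_iff]
  obtain ⟨p, hp, hpi⟩ := List.mem_iff_getElem.mp hmem
  refine ⟨p, by simpa using hp, ?_⟩
  rw [← getD_leftInvSeq_mul_wordProd, List.getD_eq_getElem _ _ hp, hpi]

end Exchange

section Dihedral

theorem exists_altWord_succ_eq_append (a b : B) (n : ℕ) :
    ∃ c, altWord a b (n + 1) = altWord a b n ++ [c] := by
  induction n generalizing a b with
  | zero => exact ⟨a, rfl⟩
  | succ n ih =>
    obtain ⟨c, hc⟩ := ih b a
    exact ⟨c, by rw [altWord, hc, altWord, List.cons_append]⟩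

theorem length_altWord (a b : B) (n : ℕ) : (altWord a b n).length = n := by
  induction n generalizing a b with
  | zero => rfl
  | succ n ih => simp [altWord, ih]

theorem exists_altWord_add_eq_append (a b : B) (n k : ℕ) :
    ∃ l, altWord a b (n + k) = altWord a b n ++ l := by
  induction k with
  | zero => exact ⟨[], by simp⟩
  | succ k ih =>
    obtain ⟨l, hl⟩ := ih
    obtain ⟨c, hc⟩ := exists_altWord_succ_eq_append a b (n + k)
    exact ⟨l ++ [c], by rw [← add_assoc, hc, hl, List.append_assoc]⟩

/-- `w` factors reducedly as the alternating word `a, b, …` with `k` letters times some element. -/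
def HasAltPrefix (cs : CoxeterSystem M W) (a b : B) (k : ℕ) (w : W) : Prop :=
  ∃ z, w = cs.wordProd (altWord a b k) * z ∧ cs.length w = k + cs.length z

theorem length_wordProd_altWord_mul_le (cs : CoxeterSystem M W) (a b : B) (k : ℕ) (z : W) :
    cs.length (cs.wordProd (altWord a b k) * z) ≤ k + cs.length z := by
  have h1 := cs.length_mul_le (cs.wordProd (altWord a b k)) z
  have h2 := cs.length_wordProd_le (altWord a b k)
  rw [length_altWord] at h2
  lia

/-- An alternating prefix extends by a left descent, unless it contains a braid relation. -/
theorem HasAltPrefix.succ_or_braid {cs : CoxeterSystem M W} {a b : B} {k : ℕ} {w : W}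
    (hw : HasAltPrefix cs a b k w) (hb : cs.IsLeftDescent w b) :
    HasAltPrefix cs b a (k + 1) w ∨
      ∃ p, cs.wordProd (altWord a b (p + 1)) = cs.wordProd (altWord b a (p + 1)) ∧
        HasAltPrefix cs a b (p + 1) w := by
  obtain ⟨z, hz, hlen⟩ := hw
  obtain ⟨ζ, hζ, rfl⟩ := cs.exists_isReduced z
  rw [hζ.eq] at hlen
  rw [← wordProd_append] at hz
  obtain ⟨p, hp, hex⟩ := exists_simple_mul_wordProd_eq_eraseIdx cs (hz ▸ hb)
  rw [List.length_append, length_altWord] at hp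
  rcases le_or_gt k p with hkp | hpk
  · left
    rw [List.eraseIdx_append_of_length_le (by rwa [length_altWord]), length_altWord,
      ← hz, wordProd_append] at hex
    have hw : w = cs.wordProd (altWord b a (k + 1)) * cs.wordProd (ζ.eraseIdx (p - k)) := by
      rw [altWord, wordProd_cons, mul_assoc, ← hex, simple_mul_simple_cancel_left]
    refine ⟨_, hw, ?_⟩
    have h1 := length_wordProd_altWord_mul_le cs b a (k + 1) (cs.wordProd (ζ.eraseIdx (p - k)))
    have h2 := cs.length_wordProd_le (ζ.eraseIdx (p - k))
    rw [List.length_eraseIdx_of_lt (by lia)] at h2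
    rw [← hw] at h1
    lia
  · right
    obtain ⟨c, hc⟩ := exists_altWord_succ_eq_append a b p
    obtain ⟨l, hl⟩ := exists_altWord_add_eq_append a b (p + 1) (k - (p + 1))
    rw [show p + 1 + (k - (p + 1)) = k by lia] at hl
    have hlen_l := congrArg List.length hl
    rw [List.length_append, length_altWord, length_altWord] at hlen_l
    have herase : (altWord a b k ++ ζ).eraseIdx p = altWord a b p ++ (l ++ ζ) := by
      rw [hl, hc, List.append_assoc, List.append_assoc,
        List.eraseIdx_append_of_length_le (by rw [length_altWord])]
      simp [length_altWord]
    rw [herase, hl, hc] at hex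
    simp only [wordProd_append, wordProd_singleton, ← mul_assoc, mul_left_inj] at hex
    refine ⟨p, ?_, cs.wordProd (l ++ ζ), ?_, ?_⟩
    · rw [hc, altWord, wordProd_cons, wordProd_append, wordProd_singleton]
      conv_lhs => rw [← hex, simple_mul_simple_cancel_right]
    · rw [hz, hl, List.append_assoc, wordProd_append]
    · have hw : w = cs.wordProd (altWord a b (p + 1)) * cs.wordProd (l ++ ζ) := by
        rw [hz, hl, List.append_assoc, wordProd_append]
      have h1 := length_wordProd_altWord_mul_le cs a b (p + 1) (cs.wordProd (l ++ ζ))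
      have h2 := cs.length_wordProd_le (l ++ ζ)
      rw [List.length_append] at h2
      rw [← hw] at h1
      lia

theorem exists_braid_prefix (cs : CoxeterSystem M W) {a b : B} {w : W}
    (ha : cs.IsLeftDescent w a) (hb : cs.IsLeftDescent w b) :
    ∃ p, cs.wordProd (altWord a b (p + 1)) = cs.wordProd (altWord b a (p + 1)) ∧
      HasAltPrefix cs a b (p + 1) w := by
  by_contra hno
  have hext (k : ℕ) : HasAltPrefix cs a b k w ∧ HasAltPrefix cs b a k w := by
    induction k with
    | zero => exact ⟨⟨w, by simp [altWord], by simp⟩, ⟨w, by simp [altWord], by simp⟩⟩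
    | succ k ih =>
      refine ⟨(ih.2.succ_or_braid ha).resolve_right ?_, (ih.1.succ_or_braid hb).resolve_right hno⟩
      rintro ⟨p, hp, hpre⟩
      exact hno ⟨p, hp.symm, by rwa [HasAltPrefix, ← hp]⟩
  obtain ⟨z, -, hz⟩ := (hext (cs.length w + 1)).1
  lia

end Dihedral

theorem exists_redL_of_isLeftDescent (cs : CoxeterSystem M W) {w : W} {i j a : B}
    (h : InGamma cs (w, i, j)) (hai : a ≠ i) (ha : cs.IsLeftDescent (w * cs.simple j) a) :
    ∃ (v : W) (i' : B), InGamma cs (v, i', j) ∧ RedL cs (w, i, j) (v, i', j) ∧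
      cs.length v < cs.length w := by
  have h' : cs.length (cs.simple i * w * cs.simple j) + 2 = cs.length w := h
  have hy := cs.length_mul_simple w j
  have hiy := cs.length_simple_mul (w * cs.simple j) i
  rw [← mul_assoc] at hiy
  have hi : cs.IsLeftDescent (w * cs.simple j) i := by
    rw [isLeftDescent_iff, ← mul_assoc]
    lia
  obtain ⟨m, hbraid, z, hz, hlen⟩ := exists_braid_prefix cs ha hi
  have hm : m ≠ 0 := by
    rintro rfl
    simp only [altWord, wordProd_singleton] at hbraid
    exact hai (simple_injective cs hbraid)
  obtain ⟨c, hc⟩ := exists_altWord_succ_eq_append a i m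
  rw [hc, altWord, wordProd_cons, wordProd_append, wordProd_singleton] at hbraid
  rw [hc, wordProd_append, wordProd_singleton] at hz
  set x := cs.wordProd (altWord a i m) with hx
  have hxm : cs.length x ≤ m := by
    simpa only [length_altWord] using cs.length_wordProd_le (altWord a i m)
  have hxc := cs.length_mul_simple x c
  have hxcz := cs.length_mul_le (x * cs.simple c) z
  rw [← hz] at hxcz
  have hv : x⁻¹ * w = cs.simple c * z * cs.simple j := by
    rw [inv_mul_eq_iff_eq_mul, ← mul_assoc, ← mul_assoc, ← hz, simple_mul_simple_cancel_right]
  have hcv : cs.simple c * (x⁻¹ * w) * cs.simple j = z := by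
    rw [hv]
    simp [mul_assoc]
  have hwx : cs.length w ≤ cs.length x + cs.length (x⁻¹ * w) := by
    simpa using cs.length_mul_le x (x⁻¹ * w)
  have hvz : cs.length (x⁻¹ * w) ≤ cs.length z + 2 := by
    have h1 := cs.length_mul_le (cs.simple c * z) (cs.simple j)
    have h2 := cs.length_mul_le (cs.simple c) z
    rw [length_simple] at h1 h2
    rw [hv]
    lia
  have hwv : w * (x⁻¹ * w)⁻¹ = x := by group
  have hgamma : InGamma cs (x⁻¹ * w, c, j) := by
    simp only [InGamma, hcv]
    lia
  refine ⟨x⁻¹ * w, c, hgamma, ⟨h, hgamma, ?_, rfl, ?_, ?_⟩, by lia⟩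
  · simp only [WeakLeftLE, hwv]
    lia
  · simp only [hwv]
    rw [hbraid, mul_inv_cancel_right]
  · simp only [hwv]
    lia

theorem exists_isLeftDescent_ne_of_redL (cs : CoxeterSystem M W) {w v : W} {i i' j : B}
    (hred : RedL cs (w, i, j) (v, i', j)) (hlt : cs.length v < cs.length w) :
    ∃ a, a ≠ i ∧ cs.IsLeftDescent (w * cs.simple j) a := by
  obtain ⟨hw, hv, hle, -, hconj, hup⟩ := hred
  simp only [InGamma, WeakLeftLE] at hw hv hle hconj hup
  set x := w * v⁻¹ with hx
  have hx1 : x ≠ 1 := by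
    rintro h1
    rw [h1, length_one] at hle
    lia
  obtain ⟨a, ha⟩ := cs.exists_leftDescent_of_ne_one hx1
  refine ⟨a, ?_, ?_⟩
  · rintro rfl
    rw [mul_inv_eq_iff_eq_mul] at hconj
    rw [IsLeftDescent, ← hconj] at ha
    lia
  · have hprod : cs.simple a * (w * cs.simple j) = cs.simple a * x * (v * cs.simple j) := by
      simp [hx, mul_assoc]
    have h1 := cs.length_mul_le (cs.simple a * x) (v * cs.simple j)
    have h2 := cs.length_simple_mul (v * cs.simple j) i'
    have h3 := cs.length_mul_simple v j
    have h4 := cs.length_mul_simple w j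
    rw [← mul_assoc] at h2
    rw [isLeftDescent_iff] at ha
    rw [IsLeftDescent, hprod]
    lia

/-- A length-decreasing left reduction from `(w, i, j)` exists iff `w sⱼ`
has more than one left descent. -/
theorem exists_length_lt_redL_iff (cs : CoxeterSystem M W) (w : W) (i j : B)
    (h : InGamma cs (w, i, j)) :
    (∃ (v : W) (i' : B), InGamma cs (v, i', j) ∧ RedL cs (w, i, j) (v, i', j) ∧
        cs.length v < cs.length w) ↔
      (∃ a b : B, a ≠ b ∧ cs.IsLeftDescent (w * cs.simple j) a ∧
        cs.IsLeftDescent (w * cs.simple j) b) := by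
  constructor
  · rintro ⟨v, i', -, hred, hlt⟩
    obtain ⟨a, hai, ha⟩ := exists_isLeftDescent_ne_of_redL cs hred hlt
    refine ⟨a, i, hai, ha, ?_⟩
    simp only [InGamma] at h
    have h1 := cs.length_mul_simple w j
    rw [IsLeftDescent, ← mul_assoc]
    lia
  · rintro ⟨a, b, hab, ha, hb⟩
    rcases eq_or_ne a i with rfl | hai
    · exact exists_redL_of_isLeftDescent cs h hab.symm hb
    · exact exists_redL_of_isLeftDescent cs h hai ha

end NilpotencyIndices
end

section
/- Let (w, i, j) ∈ Γ(W) and suppose i is the only left descent of w, i.e. D_L(w) = {i}. The following are equivalent: (1) there exist v ∈ W and j′ ∈ I with (v, i, j′) ∈ Γ(W), (w, i, j) →_R (v, i, j′), ℓ(v) < ℓ(w), and D_L(v) = {i}; (2) w has more than one right descent. -/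
open CoxeterSystem

namespace CoxeterSystem

variable {B : Type*} {W : Type*} [Group W] {M : CoxeterMatrix B} (cs : CoxeterSystem M W)

section GeometricRepresentation

/-- The linear form `2⟨αᵢ, ·⟩` on the space with basis `(αᵢ)`, where
`⟨αᵢ, αₖ⟩ = -cos (π / M i k)`. -/
noncomputable def geomForm (M : CoxeterMatrix B) (i : B) : Module.Dual ℝ (B →₀ ℝ) :=
  Finsupp.linearCombination ℝ fun k ↦ -2 * Real.cos (Real.pi / M i k)

lemma geomForm_single (M : CoxeterMatrix B) (i k : B) :
    geomForm M i (Finsupp.single k 1) = -2 * Real.cos (Real.pi / M i k) := by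
  simp [geomForm]

lemma geomForm_single_self (M : CoxeterMatrix B) (i : B) :
    geomForm M i (Finsupp.single i 1) = 2 := by
  simp [geomForm_single]

/-- The reflection in the simple root `αᵢ`. -/
noncomputable def geomReflection (M : CoxeterMatrix B) (i : B) :
    (B →₀ ℝ) ≃ₗ[ℝ] (B →₀ ℝ) :=
  Module.reflection (geomForm_single_self M i)

open Polynomial.Chebyshev in
lemma eval_chebyshevS_eq_zero {m k : ℕ} (hm : 3 ≤ m) (hk : m = 2 * k) :
    (S ℝ (k - 1)).eval (2 * Real.cos (2 * Real.pi / m)) = 0 := by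
  have hm' : (3 : ℝ) ≤ m := by exact_mod_cast hm
  have hsin : 0 < Real.sin (2 * Real.pi / m) := by
    apply Real.sin_pos_of_pos_of_lt_pi
    · positivity
    · rw [div_lt_iff₀ (by linarith)]
      nlinarith [Real.pi_pos]
  have h := S_two_mul_real_cos (2 * Real.pi / m) (k - 1)
  have harg : ((((k : ℤ) - 1 : ℤ) : ℝ) + 1) * (2 * Real.pi / m) = Real.pi := by
    have : (m : ℝ) = 2 * k := by exact_mod_cast hk
    have hk0 : (k : ℝ) ≠ 0 := by intro h0; rw [this, h0] at hm'; norm_num at hm'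
    push_cast
    rw [this]
    field_simp
    ring
  rw [harg, Real.sin_pi] at h
  exact (mul_eq_zero.mp h).resolve_right hsin.ne'

open Polynomial.Chebyshev in
lemma eval_chebyshevS_add_eq_zero {m k : ℕ} (hm : 3 ≤ m) (hk : m = 2 * k + 1) :
    (S ℝ k).eval (2 * Real.cos (2 * Real.pi / m)) +
      (S ℝ (k - 1)).eval (2 * Real.cos (2 * Real.pi / m)) = 0 := by
  have hm' : (3 : ℝ) ≤ m := by exact_mod_cast hm
  have hsin : 0 < Real.sin (2 * Real.pi / m) := by
    apply Real.sin_pos_of_pos_of_lt_pi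
    · positivity
    · rw [div_lt_iff₀ (by linarith)]
      nlinarith [Real.pi_pos]
  have h₁ := S_two_mul_real_cos (2 * Real.pi / m) k
  have h₂ := S_two_mul_real_cos (2 * Real.pi / m) (k - 1)
  have harg : (((k : ℤ) : ℝ) + 1) * (2 * Real.pi / m) =
      2 * Real.pi - ((((k : ℤ) - 1 : ℤ) : ℝ) + 1) * (2 * Real.pi / m) := by
    have : (m : ℝ) = 2 * k + 1 := by exact_mod_cast hk
    have hk0 : (2 * k + 1 : ℝ) ≠ 0 := by positivity
    push_cast
    rw [this]
    field_simp
    ring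
  rw [harg, Real.sin_two_pi_sub] at h₁
  refine (mul_eq_zero.mp ?_).resolve_right hsin.ne'
  rw [add_mul, h₁, h₂, neg_add_cancel]

lemma geomReflection_isLiftable (M : CoxeterMatrix B) : M.IsLiftable (geomReflection M) := by
  intro i k
  rcases eq_or_ne i k with rfl | hik
  · rw [M.diagonal, pow_one]
    ext1 v
    exact Module.involutive_reflection (geomForm_single_self M i) v
  have hoff := M.off_diagonal i k hik
  generalize hm : M i k = m at hoff
  have hik_form : geomForm M i (Finsupp.single k 1) = -2 * Real.cos (Real.pi / m) := by
    rw [geomForm_single, hm]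
  have hki_form : geomForm M k (Finsupp.single i 1) = -2 * Real.cos (Real.pi / m) := by
    rw [geomForm_single, M.symmetric, hm]
  rcases Nat.eq_zero_or_pos m with rfl | hpos
  · rw [pow_zero]
  rcases (by omega : m = 2 ∨ 3 ≤ m) with rfl | hm3
  · have hc : Real.cos (Real.pi / (2 : ℕ)) = 0 := by simp
    rw [hc, mul_zero] at hik_form hki_form
    ext1 v
    simp only [geomReflection, pow_two, LinearEquiv.mul_apply, LinearEquiv.coe_one, id_eq,
      Module.reflection_apply, map_sub, map_smul, hik_form, hki_form, geomForm_single_self]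
    module
  have ht : 2 * Real.cos (2 * Real.pi / m) =
      geomForm M i (Finsupp.single k 1) * geomForm M k (Finsupp.single i 1) - 2 := by
    rw [hik_form, hki_form, mul_div_assoc, Real.cos_two_mul]
    ring
  ext1 v
  rw [geomReflection, geomReflection, Module.reflection_mul_reflection_pow_apply _ _ m v _ ht]
  obtain ⟨n, hn | hn⟩ := Nat.even_or_odd' m
  · have e₁ : ((m : ℤ) - 2) / 2 = n - 1 := by omega
    have e₂ : ((m : ℤ) - 1) / 2 = n - 1 := by omega
    rw [e₁, e₂, eval_chebyshevS_eq_zero hm3 hn]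
    simp
  · have e₁ : ((m : ℤ) - 1) / 2 = n := by omega
    have e₂ : ((m : ℤ) - 3) / 2 = n - 1 := by omega
    have e₃ : (m : ℤ) / 2 = n := by omega
    have e₄ : ((m : ℤ) - 2) / 2 = n - 1 := by omega
    rw [e₁, e₂, e₃, e₄, eval_chebyshevS_add_eq_zero hm3 hn]
    simp

/-- The simple reflections of a Coxeter system are pairwise distinct. -/
theorem simple_injective : Function.Injective cs.simple := by
  intro a b hab
  by_contra hne
  have h := congrArg (cs.lift ⟨geomReflection M, geomReflection_isLiftable M⟩) hab
  rw [lift_apply_simple, lift_apply_simple] at h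
  have h' := congrArg (fun v : B →₀ ℝ ↦ v a)
    (LinearEquiv.congr_fun h (Finsupp.single a 1))
  simp [geomReflection, Module.reflection_apply, Ne.symm hne] at h'
  norm_num at h'

end GeometricRepresentation

section Exchange

lemma prod_map_alternatingWord {G : Type*} [Monoid G] (f : B → G) (i j : B) (p : ℕ) :
    ((alternatingWord i j (2 * p)).map f).prod = (f i * f j) ^ p := by
  induction p with
  | zero => simp [alternatingWord]
  | succ p ih =>
    rw [mul_add_one, alternatingWord_succ, alternatingWord_succ]
    simp [ih, pow_succ]

lemma reverse_alternatingWord (i j : B) (p : ℕ) :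
    (alternatingWord i j (2 * p)).reverse = alternatingWord j i (2 * p) := by
  induction p with
  | zero => simp [alternatingWord]
  | succ p ih =>
    rw [mul_add_one, alternatingWord_succ, alternatingWord_succ,
      alternatingWord_succ' j i (2 * p + 1), alternatingWord_succ' j i (2 * p)]
    simp [ih]

open Classical in
lemma even_count_rightInvSeq_alternatingWord (i j : B) (t : W) :
    Even ((cs.rightInvSeq (alternatingWord i j (2 * M i j))).count t) := by
  set m := M i j with hm
  let g : ℕ → W := fun k ↦ cs.wordProd (alternatingWord i j (2 * k + 1))
  have hg : ∀ k, g (m + k) = g k := by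
    intro k
    have e₁ : (2 * (m + k) + 1) / 2 = m + k := by omega
    have e₂ : (2 * k + 1) / 2 = k := by omega
    simp only [g, prod_alternatingWord_eq_mul_pow, e₁, e₂, pow_add]
    rw [hm, cs.simple_mul_simple_pow]
    simp
  have hlis : cs.leftInvSeq (alternatingWord j i (2 * m)) = (List.range (2 * m)).map g := by
    apply List.ext_getElem
    · simp
    · intro k h₁ h₂
      rw [cs.getElem_leftInvSeq_alternatingWord j i m k (by simpa using h₂)]
      simp [g]
  rw [← reverse_alternatingWord j i, rightInvSeq_reverse, List.count_reverse, hlis, two_mul,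
    List.range_add, List.map_append, List.map_map, List.count_append]
  have : (List.range m).map (g ∘ fun x ↦ m + x) = (List.range m).map g :=
    List.map_congr_left fun k _ ↦ hg k
  rw [this]
  exact ⟨_, rfl⟩

open Classical in
/-- The action of `sᵢ` on signed group elements: conjugation, flipping the sign of `sᵢ`. -/
noncomputable def signedConj (i : B) : Function.End (W × ZMod 2) :=
  fun x ↦ (cs.simple i * x.1 * (cs.simple i)⁻¹, x.2 + if x.1 = cs.simple i then 1 else 0)

open Classical in
lemma prod_map_signedConj (ω : List B) (x : W × ZMod 2) :
    (ω.map cs.signedConj).prod x =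
      (cs.wordProd ω * x.1 * (cs.wordProd ω)⁻¹, x.2 + ((cs.rightInvSeq ω).count x.1 : ZMod 2)) := by
  induction ω with
  | nil =>
    simp only [List.map_nil, List.prod_nil, wordProd_nil, rightInvSeq_nil, List.count_nil]
    change x = _
    simp
  | cons i ω ih =>
    rw [List.map_cons, List.prod_cons]
    change cs.signedConj i ((ω.map cs.signedConj).prod x) = _
    have hiff : cs.wordProd ω * x.1 * (cs.wordProd ω)⁻¹ = cs.simple i ↔
        (cs.wordProd ω)⁻¹ * cs.simple i * cs.wordProd ω = x.1 := by
      constructor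
      · intro h
        rw [← h]
        group
      · intro h
        rw [← h]
        group
    rw [ih, signedConj, rightInvSeq, List.count_cons, wordProd_cons]
    ext1
    · simp [mul_assoc]
    · simp only [beq_iff_eq, hiff]
      push_cast
      ring

lemma signedConj_isLiftable : M.IsLiftable cs.signedConj := by
  classical
  intro i j
  rw [← prod_map_alternatingWord]
  funext x
  rw [prod_map_signedConj, prod_alternatingWord_eq_mul_pow]
  obtain ⟨n, hn⟩ := cs.even_count_rightInvSeq_alternatingWord i j x.1
  have h2 : ((n + n : ℕ) : ZMod 2) = 0 := by
    push_cast
    exact CharTwo.add_self_eq_zero _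
  rw [hn, h2]
  change _ = x
  simp

open Classical in
lemma count_rightInvSeq_congr {ω ω' : List B} (h : cs.wordProd ω = cs.wordProd ω') (t : W) :
    ((cs.rightInvSeq ω).count t : ZMod 2) = (cs.rightInvSeq ω').count t := by
  have key : ∀ ω : List B, cs.lift ⟨_, cs.signedConj_isLiftable⟩ (cs.wordProd ω) =
      (ω.map cs.signedConj).prod := by
    intro ω
    rw [wordProd, map_list_prod, List.map_map]
    congr 1
    exact List.map_congr_left fun i _ ↦ cs.lift_apply_simple _ i
  have h' := congrFun ((key ω).symm.trans ((congrArg _ h).trans (key ω'))) (t, 0)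
  rw [prod_map_signedConj, prod_map_signedConj] at h'
  simpa using congrArg Prod.snd h'

/-- Every word for `w` has each simple right descent of `w` in its right inversion sequence. -/
lemma simple_mem_rightInvSeq_of_isRightDescent {ω : List B} {j : B}
    (h : cs.IsRightDescent (cs.wordProd ω) j) : cs.simple j ∈ cs.rightInvSeq ω := by
  classical
  by_contra hmem
  obtain ⟨ρ, hρ, hρ'⟩ := cs.exists_isReduced (cs.wordProd ω * cs.simple j)
  have hcount := cs.count_rightInvSeq_congr (ω := ω) (ω' := ρ.concat j)
    (by rw [wordProd_concat, ← hρ']; simp) (cs.simple j)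
  rw [List.count_eq_zero_of_not_mem hmem, rightInvSeq_concat, List.concat_eq_append,
    List.count_append] at hcount
  have hmap : (((cs.rightInvSeq ρ).map (MulAut.conj (cs.simple j))).count (cs.simple j)) =
      (cs.rightInvSeq ρ).count (cs.simple j) := by
    conv_lhs => rw [show cs.simple j = MulAut.conj (cs.simple j) (cs.simple j) by simp]
    simpa using List.count_map_of_injective (cs.rightInvSeq ρ) (MulAut.conj (cs.simple j))
      (MulAut.conj (cs.simple j)).injective (cs.simple j)
  rw [hmap] at hcount
  have hmem' : cs.simple j ∈ cs.rightInvSeq ρ := by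
    by_contra hn
    rw [List.count_eq_zero_of_not_mem hn] at hcount
    simp at hcount
  have hlt := (cs.isRightInversion_of_mem_rightInvSeq hρ hmem').2
  rw [← hρ'] at hlt
  rw [IsRightDescent] at h
  simp at hlt
  omega

/-- The exchange property. -/
theorem exists_wordProd_mul_simple_eq {ω : List B} {j : B}
    (h : cs.IsRightDescent (cs.wordProd ω) j) :
    ∃ p c q, ω = p ++ c :: q ∧ cs.wordProd ω * cs.simple j = cs.wordProd (p ++ q) := by
  obtain ⟨k, hk, hk'⟩ := List.mem_iff_getElem.mp (cs.simple_mem_rightInvSeq_of_isRightDescent h)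
  have hk₀ : k < ω.length := by simpa using hk
  refine ⟨ω.take k, ω[k], ω.drop (k + 1), by simp, ?_⟩
  rw [← List.eraseIdx_eq_take_drop_succ, ← wordProd_mul_getD_rightInvSeq,
    List.getD_eq_getElem _ 1 hk, hk']

end Exchange

section Parabolic

lemma length_mul_wordProd_of_minimal {J : Set B} {u : W}
    (hu : ∀ ω : List B, (∀ c ∈ ω, c ∈ J) → cs.length u ≤ cs.length (u * cs.wordProd ω))
    (ω : List B) (hω : ∀ c ∈ ω, c ∈ J)
    (hmin : ∀ ω' : List B, (∀ c ∈ ω', c ∈ J) → cs.wordProd ω' = cs.wordProd ω →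
      ω.length ≤ ω'.length) :
    cs.length (u * cs.wordProd ω) = cs.length u + ω.length := by
  induction ω using List.reverseRecOn with
  | nil => simp
  | append_singleton ω c ih =>
    have hc : c ∈ J := hω c (by simp)
    have hω₁ : ∀ d ∈ ω, d ∈ J := fun d hd ↦ hω d (by simp [hd])
    have ih' := ih hω₁ fun ω' h₁ h₂ ↦ by
      have := hmin (ω' ++ [c]) (by
        intro d hd
        rcases List.mem_append.mp hd with hd | hd
        · exact h₁ d hd
        · rwa [List.mem_singleton.mp hd]) (by rw [wordProd_append, wordProd_append, h₂])
      simpa using this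
    rw [wordProd_append, wordProd_singleton, ← mul_assoc, List.length_append,
      List.length_singleton, ← add_assoc, ← ih', ← not_isRightDescent_iff]
    intro hdesc
    obtain ⟨ρ, hρ, rfl⟩ := cs.exists_isReduced u
    rw [← wordProd_append] at hdesc
    obtain ⟨p, d, q, hpq, hprod⟩ := cs.exists_wordProd_mul_simple_eq hdesc
    rcases List.append_eq_append_iff.mp hpq with ⟨r, rfl, hr⟩ | ⟨r, rfl, hr⟩
    · have hshort := hmin (r ++ q) (by
        intro e he
        apply hω₁
        rw [hr]
        rcases List.mem_append.mp he with he | he <;> simp [he]) (by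
        rw [List.append_assoc, wordProd_append, wordProd_append, mul_assoc] at hprod
        rw [cs.wordProd_append ω, wordProd_singleton]
        exact (mul_left_cancel hprod).symm)
      rw [hr] at hshort
      simp at hshort
    · rcases r with _ | ⟨e, r⟩
      · have hshort := hmin q (by
          intro e he
          apply hω₁
          simp only [List.nil_append] at hr
          rw [← hr]
          simp [he]) (by
          rw [List.append_nil, wordProd_append, wordProd_append, mul_assoc] at hprod
          rw [cs.wordProd_append ω, wordProd_singleton]
          exact (mul_left_cancel hprod).symm)
        simp only [List.nil_append] at hr
        rw [← hr] at hshort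
        simp at hshort
      · simp only [List.cons_append, List.cons.injEq] at hr
        obtain ⟨rfl, rfl⟩ := hr
        have hlen := hu (ω ++ [c] ++ ω.reverse) (by
          intro e he
          simp only [List.mem_append, List.mem_reverse] at he
          rcases he with (he | he) | he
          · exact hω₁ e he
          · rwa [List.mem_singleton.mp he]
          · exact hω₁ e he)
        have heq : cs.wordProd (p ++ d :: r) * cs.wordProd (ω ++ [c] ++ ω.reverse) =
            cs.wordProd (p ++ r) := by
          rw [wordProd_append _ (ω ++ [c]), cs.wordProd_append ω, wordProd_singleton, ← mul_assoc,
            ← mul_assoc, ← wordProd_append, hprod, ← List.append_assoc, wordProd_append,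
            wordProd_reverse, mul_inv_cancel_right]
        rw [heq, hρ.eq] at hlen
        have := cs.length_wordProd_le (p ++ r)
        simp at hlen this
        omega

lemma exists_wordProd_eq_length_minimal {J : Set B} (ω : List B) (hω : ∀ c ∈ ω, c ∈ J) :
    ∃ ζ : List B, (∀ c ∈ ζ, c ∈ J) ∧ cs.wordProd ζ = cs.wordProd ω ∧
      ∀ ω' : List B, (∀ c ∈ ω', c ∈ J) → cs.wordProd ω' = cs.wordProd ζ →
        ζ.length ≤ ω'.length := by
  let A : Set (List B) := {ζ | (∀ c ∈ ζ, c ∈ J) ∧ cs.wordProd ζ = cs.wordProd ω}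
  have hA : A.Nonempty := ⟨ω, hω, rfl⟩
  obtain ⟨h₁, h₂⟩ := Function.argminOn_mem List.length A hA
  refine ⟨_, h₁, h₂, fun ω' h₃ h₄ ↦ not_lt.mp ?_⟩
  exact Function.not_lt_argminOn List.length A (show ω' ∈ A from ⟨h₃, h₄.trans h₂⟩)

/-- An element of a standard parabolic subgroup has a reduced word in its generators. -/
lemma exists_isReduced_of_forall_mem {J : Set B} (ω : List B) (hω : ∀ c ∈ ω, c ∈ J) :
    ∃ ζ : List B, (∀ c ∈ ζ, c ∈ J) ∧ cs.wordProd ζ = cs.wordProd ω ∧ cs.IsReduced ζ := by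
  obtain ⟨ζ, hζ, hζω, hmin⟩ := cs.exists_wordProd_eq_length_minimal ω hω
  refine ⟨ζ, hζ, hζω, ?_⟩
  simpa [IsReduced] using cs.length_mul_wordProd_of_minimal (u := 1) (by simp) ζ hζ hmin

lemma length_mul_wordProd_of_forall_le {J : Set B} {u : W}
    (hu : ∀ ω : List B, (∀ c ∈ ω, c ∈ J) → cs.length u ≤ cs.length (u * cs.wordProd ω))
    (ω : List B) (hω : ∀ c ∈ ω, c ∈ J) :
    cs.length (u * cs.wordProd ω) = cs.length u + cs.length (cs.wordProd ω) := by
  obtain ⟨ζ, hζ, hζω, hmin⟩ := cs.exists_wordProd_eq_length_minimal ω hω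
  have h := cs.length_mul_wordProd_of_minimal (u := 1) (by simp) ζ hζ hmin
  rw [one_mul, length_one, zero_add] at h
  rw [← hζω, h, cs.length_mul_wordProd_of_minimal hu ζ hζ hmin]

/-- The parabolic decomposition `w = u y`, where `u` is of minimal length in its coset and `y` lies
in the standard parabolic subgroup generated by `J`. -/
theorem exists_parabolic_decomposition (J : Set B) (w : W) :
    ∃ (u : W) (ω : List B), (∀ c ∈ ω, c ∈ J) ∧ w = u * cs.wordProd ω ∧
      ∀ ζ : List B, (∀ c ∈ ζ, c ∈ J) →
        cs.length (u * cs.wordProd ζ) = cs.length u + cs.length (cs.wordProd ζ) := by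
  let A : Set (List B) := {ω | ∀ c ∈ ω, c ∈ J}
  have hA : A.Nonempty := ⟨[], by simp [A]⟩
  let f : List B → ℕ := fun ω ↦ cs.length (w * cs.wordProd ω)
  set ω := Function.argminOn f A hA
  have hω : ∀ c ∈ ω, c ∈ J := Function.argminOn_mem f A hA
  refine ⟨w * cs.wordProd ω, ω.reverse, by simpa using hω, by simp, ?_⟩
  refine cs.length_mul_wordProd_of_forall_le fun ζ hζ ↦ not_lt.mp ?_
  have hmem : ω ++ ζ ∈ A := fun c hc ↦ (List.mem_append.mp hc).elim (hω c) (hζ c)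
  have := Function.not_lt_argminOn f A hmem
  rw [mul_assoc, ← wordProd_append]
  exact this

lemma not_isReduced_append_cons_cons (p q : List B) (c : B) :
    ¬cs.IsReduced (p ++ c :: c :: q) := by
  intro h
  have h₁ : cs.wordProd (p ++ c :: c :: q) = cs.wordProd (p ++ q) := by
    simp [wordProd_append, wordProd_cons]
  have h₂ := cs.length_wordProd_le (p ++ q)
  rw [← h₁, h.eq] at h₂
  simp at h₂

/-- If both generators of a dihedral parabolic subgroup are right descents of an element `y` of it,
then conjugation by `y` permutes them. -/
lemma exists_mul_simple_eq_simple_mul {a b : B} (hab : a ≠ b) (ω : List B)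
    (hω : ∀ c ∈ ω, c ∈ ({a, b} : Set B)) (ha : cs.IsRightDescent (cs.wordProd ω) a)
    (hb : cs.IsRightDescent (cs.wordProd ω) b) :
    ∃ c ∈ ({a, b} : Set B), cs.wordProd ω * cs.simple a = cs.simple c * cs.wordProd ω := by
  obtain ⟨ζ, hζ, hζω, hred⟩ := cs.exists_isReduced_of_forall_mem (J := {a, b}) (ω ++ [b]) (by
    intro c hc
    rcases List.mem_append.mp hc with hc | hc
    · exact hω c hc
    · simp [List.mem_singleton.mp hc])
  rw [wordProd_append, wordProd_singleton] at hζω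
  have hωζ : cs.wordProd (ζ ++ [b]) = cs.wordProd ω := by
    rw [wordProd_append, hζω]
    simp
  have hζb : ∀ c ∈ ζ ++ [b], c = a ∨ c = b := by
    intro c hc
    rcases List.mem_append.mp hc with hc | hc
    · exact hζ c hc
    · exact Or.inr (List.mem_singleton.mp hc)
  have hred' : cs.IsReduced (ζ ++ [b]) := by
    have := cs.isRightDescent_iff.mp hb
    rw [← hζω, hred.eq, ← hωζ] at this
    simp [IsReduced, ← this]
  rw [← hωζ] at ha ⊢
  obtain ⟨p, c, q, hpq, hprod⟩ := cs.exists_wordProd_mul_simple_eq ha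
  rw [hpq] at hred' hζb
  have hred₂ : cs.IsReduced (p ++ q) := by
    have := cs.isRightDescent_iff.mp ha
    rw [hprod, hpq, hred'.eq] at this
    simp at this
    simp [IsReduced]
    omega
  rcases List.eq_nil_or_concat p with rfl | ⟨p, x, rfl⟩
  · refine ⟨c, hζb c (by simp), ?_⟩
    rw [hprod, hpq]
    simp [wordProd_cons]
  · exfalso
    rcases q with _ | ⟨z, q⟩
    · rw [List.concat_eq_append] at hpq hprod
      obtain ⟨hζp, -⟩ := List.append_inj' hpq rfl
      rw [List.append_nil, ← hζp, hωζ, hζω] at hprod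
      exact hab (cs.simple_injective (mul_left_cancel hprod))
    · have hxc : x ≠ c := by
        rintro rfl
        exact cs.not_isReduced_append_cons_cons p (z :: q) x (by simpa using hred')
      have hcz : c ≠ z := by
        rintro rfl
        exact cs.not_isReduced_append_cons_cons _ q c hred'
      have hxz : x ≠ z := by
        rintro rfl
        exact cs.not_isReduced_append_cons_cons p q x (by simpa using hred₂)
      have hx := hζb x (by simp)
      have hc := hζb c (by simp)
      have hz := hζb z (by simp)
      grind

end Parabolic

end CoxeterSystem

namespace NilpotencyIndices

variable {B : Type*} {W : Type*} [Group W] {M : CoxeterMatrix B}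

/-- If `i` is the only left descent of `w`, a length-decreasing right reduction preserving
`D_L = {i}` exists iff `w` has more than one right descent. -/
theorem exists_redR_unique_left_descent_iff (cs : CoxeterSystem M W) (w : W) (i j : B)
    (h : InGamma cs (w, i, j)) (hD : {k : B | cs.IsLeftDescent w k} = {i}) :
    (∃ (v : W) (j' : B), InGamma cs (v, i, j') ∧ RedR cs (w, i, j) (v, i, j') ∧
        cs.length v < cs.length w ∧ {k : B | cs.IsLeftDescent v k} = {i}) ↔
      (∃ a b : B, a ≠ b ∧ cs.IsRightDescent w a ∧ cs.IsRightDescent w b) := by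
  have hDi : ∀ k, cs.IsLeftDescent w k ↔ k = i := fun k ↦ by
    simpa using Set.ext_iff.mp hD k
  have hwi : cs.IsLeftDescent w i := (hDi i).mpr rfl
  have hwj : cs.IsRightDescent w j := by
    have h' : cs.length (cs.simple i * w * cs.simple j) + 2 = cs.length w := h
    have h₁ := cs.isLeftDescent_iff.mp hwi
    have h₂ := cs.length_simple_mul (w * cs.simple j) i
    rw [← mul_assoc] at h₂
    unfold IsRightDescent
    omega
  constructor
  · rintro ⟨v, j', -, ⟨-, -, hle, -, -, hx⟩, hlt, -⟩
    change cs.length v + cs.length (v⁻¹ * w) = cs.length w at hle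
    change cs.length (v⁻¹ * w * cs.simple j) = cs.length (v⁻¹ * w) + 1 at hx
    have hne : v⁻¹ * w ≠ 1 := by
      intro h1
      rw [h1, length_one] at hle
      omega
    obtain ⟨k, hk⟩ := cs.exists_rightDescent_of_ne_one hne
    refine ⟨j, k, ?_, hwj, ?_⟩
    · rintro rfl
      unfold IsRightDescent at hk
      omega
    · have hmul := cs.length_mul_le v (v⁻¹ * w * cs.simple k)
      rw [show v * (v⁻¹ * w * cs.simple k) = w * cs.simple k by group] at hmul
      unfold IsRightDescent at hk ⊢
      omega
  · rintro ⟨a, b, hab, ha, hb⟩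
    obtain ⟨k, hjk, hwk⟩ : ∃ k, j ≠ k ∧ cs.IsRightDescent w k := by
      by_cases haj : j = a
      · exact ⟨b, haj ▸ hab, hb⟩
      · exact ⟨a, haj, ha⟩
    obtain ⟨u, ω, hω, hw, hlen⟩ := cs.exists_parabolic_decomposition {j, k} w
    set y := cs.wordProd ω with hy
    have hdesc : ∀ c ∈ ({j, k} : Set B), cs.IsRightDescent w c → cs.IsRightDescent y c := by
      intro c hc hwc
      have h₁ := hlen (ω ++ [c]) (by
        intro d hd
        rcases List.mem_append.mp hd with hd | hd
        · exact hω d hd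
        · rwa [List.mem_singleton.mp hd])
      have h₂ := hlen ω hω
      rw [wordProd_append, wordProd_singleton, ← hy, ← mul_assoc, ← hw] at h₁
      rw [← hy, ← hw] at h₂
      unfold IsRightDescent at hwc ⊢
      omega
    have hyj := hdesc j (by simp) hwj
    have hyk := hdesc k (by simp) hwk
    obtain ⟨c, hc, hyc⟩ := cs.exists_mul_simple_eq_simple_mul hjk ω hω hyj hyk
    obtain ⟨d, -, hyd⟩ := cs.exists_mul_simple_eq_simple_mul hjk.symm ω
      (by rwa [Set.pair_comm]) hyk hyj
    rw [← hy] at hyc hyd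
    have hleft : ∀ (e f : B), cs.IsRightDescent y f →
        y * cs.simple f = cs.simple e * y → cs.IsLeftDescent y e := by
      intro e f hf hef
      unfold IsLeftDescent
      rwa [← hef]
    have hyc_left := hleft c j hyj hyc
    have hw_len : cs.length w = cs.length u + cs.length y := by
      rw [hw]
      exact hlen ω hω
    have huc_len : cs.length (u * cs.simple c) = cs.length u + 1 := by
      simpa using hlen [c] (by simpa using hc)
    have hu : u ≠ 1 := by
      rintro rfl
      rw [one_mul] at hw
      have hci := (hDi c).mp (hw ▸ hyc_left)
      have hdi := (hDi d).mp (hw ▸ hleft d k hyk hyd)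
      rw [hci] at hyc
      rw [hdi, ← hyc] at hyd
      exact hjk (cs.simple_injective (mul_left_cancel hyd).symm)
    have hy_len : 2 ≤ cs.length y := by
      by_contra hlt
      have hj := cs.isRightDescent_iff.mp hyj
      have hk := cs.isRightDescent_iff.mp hyk
      have hj₁ := cs.length_eq_zero_iff.mp (show cs.length (y * cs.simple j) = 0 by omega)
      have hk₁ := cs.length_eq_zero_iff.mp (show cs.length (y * cs.simple k) = 0 by omega)
      exact hjk (cs.simple_injective (mul_left_cancel (hj₁.trans hk₁.symm)))
    have hu_desc : ∀ e, cs.IsLeftDescent u e → e = i := by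
      intro e he
      have h₁ := cs.length_mul_le (cs.simple e * u) y
      rw [mul_assoc, ← hw] at h₁
      refine (hDi e).mp ?_
      unfold IsLeftDescent at he ⊢
      omega
    have hui : cs.IsLeftDescent u i := by
      obtain ⟨e, he⟩ := cs.exists_leftDescent_of_ne_one hu
      exact hu_desc e he ▸ he
    have hvw : (u * cs.simple c)⁻¹ * w = cs.simple c * y := by
      rw [hw]
      simp [mul_assoc]
    have hcy := cs.isLeftDescent_iff.mp hyc_left
    have hgamma : InGamma cs (u * cs.simple c, i, c) := by
      have := cs.isLeftDescent_iff.mp hui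
      simp only [InGamma, huc_len]
      rw [mul_assoc, mul_assoc, simple_mul_simple_self, mul_one]
      omega
    refine ⟨u * cs.simple c, c, hgamma, ⟨h, hgamma, ?_, rfl, ?_, ?_⟩, by omega, ?_⟩
    · simp only [WeakRightLE, hvw]
      omega
    · simp only [hvw]
      rw [mul_assoc _ y, hyc]
      simp
    · simp only [hvw]
      rw [mul_assoc _ y, hyc, simple_mul_simple_cancel_left]
      exact hcy.symm
    · ext e
      simp only [Set.mem_ofPred_eq, Set.mem_singleton_iff]
      constructor
      · intro he
        have h₁ := cs.length_mul_le (cs.simple e * (u * cs.simple c)) (cs.simple c * y)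
        rw [show cs.simple e * (u * cs.simple c) * (cs.simple c * y) = cs.simple e * w by
          rw [hw]; simp [mul_assoc]] at h₁
        refine (hDi e).mp ?_
        unfold IsLeftDescent at he ⊢
        omega
      · rintro rfl
        have h₁ := cs.length_mul_le (cs.simple e * u) (cs.simple c)
        rw [length_simple, mul_assoc] at h₁
        unfold IsLeftDescent at hui ⊢
        omega

end NilpotencyIndices
end
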